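/- Let Λ be a block, c a cup diagram compatible with Λ, and γ = {i, j} with i < j a cup of c. Then the distance d_Λ(γ) = p_Λ(j) − p_Λ(i) is odd; in particular the saddle width s_Λ(γ) = (d_Λ(γ) + 1)/2 is a positive integer. -/

import Mathlib

namespace BK

/-- The symbols `∘, ×, ∨, ∧` labelling the integral positions of a weight. -/
inductive Symb : Type
  | circ : Symb
  | times : Symb
  | dn : Symb
  | up : Symb
  deriving DecidableEq

/-- A (diagrammatical) weight: a sequence of symbols indexed by `ℤ`, equal to `∘`
for all but finitely many positions. -/
structure Weight : Type where
  lab : ℤ → Symb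
  finite : {i : ℤ | lab i ≠ Symb.circ}.Finite

namespace Weight

/-- Two weights are equivalent (lie in the same block) if one is obtained from the
other by permuting the symbols `∧` and `∨`: the `∘`- and `×`-positions agree and the
number of `∧`'s agrees. -/
def Equiv (l m : Weight) : Prop :=
  (∀ i, l.lab i = Symb.circ ↔ m.lab i = Symb.circ) ∧
  (∀ i, l.lab i = Symb.times ↔ m.lab i = Symb.times) ∧
  {i | l.lab i = Symb.up}.ncard = {i | m.lab i = Symb.up}.ncard

/-- The vertices of (the block of) a weight: the positions carrying `∧` or `∨`,
i.e. the positions where the block sequence has the symbol `★`. -/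
def vertices (l : Weight) : Set ℤ :=
  {i | l.lab i = Symb.up ∨ l.lab i = Symb.dn}

/-- `up(Λ)`: the number of `∧`'s plus the number of `×`'s. -/
noncomputable def upNum (l : Weight) : ℕ :=
  {i | l.lab i = Symb.up}.ncard + {i | l.lab i = Symb.times}.ncard

/-- `down(Λ)`: the number of `∨`'s plus the number of `×`'s. -/
noncomputable def downNum (l : Weight) : ℕ :=
  {i | l.lab i = Symb.dn}.ncard + {i | l.lab i = Symb.times}.ncard

/-- A block is balanced if `up(Λ) = down(Λ)`. -/
def Balanced (l : Weight) : Prop := l.upNum = l.downNum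

end Weight

/-- A cup diagram (equally: the datum of a cap diagram, via the mirror image):
a set of cups `(i, j)` with `i < j` and a set of rays `i`. -/
@[ext]
structure CupDiagram : Type where
  cups : Set (ℤ × ℤ)
  rays : Set ℤ

namespace CupDiagram

/-- Compatibility of a cup diagram with the vertex set `V` of a block: endpoints lie in
`V` and are increasing, every vertex lies in exactly one arc, cups do not cross, and no
ray lies under a cup. -/
def IsCompatible (c : CupDiagram) (V : Set ℤ) : Prop :=
  (∀ p ∈ c.cups, p.1 < p.2) ∧
  (∀ p ∈ c.cups, p.1 ∈ V ∧ p.2 ∈ V) ∧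
  c.rays ⊆ V ∧
  (∀ v ∈ V, v ∈ c.rays ∨ ∃ p ∈ c.cups, v = p.1 ∨ v = p.2) ∧
  (∀ p ∈ c.cups, ∀ q ∈ c.cups,
    (p.1 = q.1 ∨ p.1 = q.2 ∨ p.2 = q.1 ∨ p.2 = q.2) → p = q) ∧
  (∀ p ∈ c.cups, p.1 ∉ c.rays ∧ p.2 ∉ c.rays) ∧
  (∀ p ∈ c.cups, ∀ q ∈ c.cups, ¬(p.1 < q.1 ∧ q.1 < p.2 ∧ p.2 < q.2)) ∧
  (∀ p ∈ c.cups, ∀ k ∈ c.rays, ¬(p.1 < k ∧ k < p.2))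

/-- The diagram `cλ` is oriented: every cup has exactly one endpoint `∨` and one `∧`,
every ray vertex is labeled `∨` or `∧`, and there are no rays `i < j` with
`λ_i = ∨` and `λ_j = ∧`. -/
def Oriented (c : CupDiagram) (l : Weight) : Prop :=
  (∀ p ∈ c.cups,
    (l.lab p.1 = Symb.dn ∧ l.lab p.2 = Symb.up) ∨
    (l.lab p.1 = Symb.up ∧ l.lab p.2 = Symb.dn)) ∧
  (∀ k ∈ c.rays, l.lab k = Symb.up ∨ l.lab k = Symb.dn) ∧
  (∀ i ∈ c.rays, ∀ j ∈ c.rays, i < j → ¬(l.lab i = Symb.dn ∧ l.lab j = Symb.up))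

/-- The degree of `cλ`: the number of clockwise cups (cups whose rightmost vertex is
labeled `∨`).  Applied to the mirror cap diagram this is the number of clockwise caps. -/
noncomputable def deg (c : CupDiagram) (l : Weight) : ℕ :=
  {p ∈ c.cups | l.lab p.2 = Symb.dn}.ncard

end CupDiagram

/-- `c` is the cup diagram `underline l` of the weight `l`: it is compatible with the
block of `l`, the diagram `c l` is oriented, and `deg (c l) = 0`. -/
def IsLowerDiagram (c : CupDiagram) (l : Weight) : Prop :=
  c.IsCompatible l.vertices ∧ c.Oriented l ∧ c.deg l = 0

/-- Adjacency of vertices in the circle diagram `c d*`: two vertices are adjacent when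
they are joined by a cup of `c` or a cap of `d*`. -/
def adjArc (c d : CupDiagram) (v w : ℤ) : Prop :=
  (v, w) ∈ c.cups ∨ (w, v) ∈ c.cups ∨ (v, w) ∈ d.cups ∨ (w, v) ∈ d.cups

/-- `S` is a connected component of the circle diagram `c d*`. -/
def IsComponent (c d : CupDiagram) (S : Set ℤ) : Prop :=
  ∃ v ∈ S, S = {w | Relation.ReflTransGen (adjArc c d) v w}

/-- `S` is a circle of the circle diagram `c d*`: a connected component containing
no ray. -/
def IsCircle (c d : CupDiagram) (S : Set ℤ) : Prop :=
  IsComponent c d S ∧ ∀ v ∈ S, v ∉ c.rays ∧ v ∉ d.rays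

/-- The degree of the oriented circle diagram `c n d*`: the number of clockwise cups
of `c n` plus the number of clockwise caps of `n d*`. -/
noncomputable def degCirc (c d : CupDiagram) (n : Weight) : ℕ :=
  {p ∈ c.cups | n.lab p.2 = Symb.dn}.ncard + {p ∈ d.cups | n.lab p.2 = Symb.dn}.ncard

/-- The position `p_Λ(i)` of `i` in the block of `l`. -/
noncomputable def posn (l : Weight) (i : ℤ) : ℕ :=
  {j | j ≤ i ∧ (l.lab j = Symb.up ∨ l.lab j = Symb.dn)}.ncard +
    2 * {j | j ≤ i ∧ l.lab j = Symb.times}.ncard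

/-- The distance `d_Λ(γ) = |p_Λ(i) − p_Λ(j)|` of an arc `γ = {i, j}`. -/
noncomputable def arcDist (l : Weight) (i j : ℤ) : ℕ := ((posn l i : ℤ) - (posn l j : ℤ)).natAbs


/-- The vertices strictly below a cup are paired by the cups nested in it, so their number
is even. -/
theorem even_ncard_vertices_below_cup {c : CupDiagram} {V : Set ℤ} (hc : c.IsCompatible V)
    {p : ℤ × ℤ} (hp : p ∈ c.cups) : Even (V ∩ Set.Ioo p.1 p.2).ncard := by
  obtain ⟨hlt, hV, -, hcover, huniq, -, hcross, hray⟩ := hc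
  set A : Set (ℤ × ℤ) := {q ∈ c.cups | p.1 < q.1 ∧ q.1 < p.2}
  have hnested : ∀ q ∈ A, q.2 < p.2 := by
    rintro q ⟨hq, h1, h2⟩
    rcases lt_trichotomy q.2 p.2 with h | h | h
    · exact h
    · have := huniq p hp q hq (by simp [h])
      subst this
      exact absurd h1 (lt_irrefl _)
    · exact absurd ⟨h1, h2, h⟩ (hcross p hp q hq)
  have hunion : V ∩ Set.Ioo p.1 p.2 = Prod.fst '' A ∪ Prod.snd '' A := by
    ext v
    constructor
    · rintro ⟨hv, h1, h2⟩
      rcases hcover v hv with hr | ⟨q, hq, rfl | rfl⟩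
      · exact absurd ⟨h1, h2⟩ (hray p hp v hr)
      · exact Or.inl ⟨q, ⟨hq, h1, h2⟩, rfl⟩
      · refine Or.inr ⟨q, ⟨hq, ?_, (hlt q hq).trans h2⟩, rfl⟩
        rcases lt_trichotomy p.1 q.1 with h | h | h
        · exact h
        · have := huniq p hp q hq (Or.inl h)
          subst this
          exact absurd h2 (lt_irrefl _)
        · exact absurd ⟨h, h1, h2⟩ (hcross q hq p hp)
    · rintro (⟨q, hq, rfl⟩ | ⟨q, hq, rfl⟩)
      · exact ⟨(hV q hq.1).1, hq.2⟩
      · exact ⟨(hV q hq.1).2, hq.2.1.trans (hlt q hq.1), hnested q hq⟩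
  have hfin : (V ∩ Set.Ioo p.1 p.2).Finite := (Set.finite_Ioo _ _).inter_of_right V
  rw [hunion, Set.finite_union] at hfin
  have hdisj : Disjoint (Prod.fst '' A) (Prod.snd '' A) := by
    rw [Set.disjoint_left]
    rintro v ⟨q, hq, rfl⟩ ⟨r, hr, h⟩
    have := huniq q hq.1 r hr.1 (Or.inr (Or.inl h.symm))
    subst this
    exact (hlt q hq.1).ne' h
  have hfst : Set.InjOn Prod.fst A := fun q hq r hr h => huniq q hq.1 r hr.1 (Or.inl h)
  have hsnd : Set.InjOn Prod.snd A := fun q hq r hr h =>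
    huniq q hq.1 r hr.1 (Or.inr (Or.inr (Or.inr h)))
  rw [hunion, Set.ncard_union_eq hdisj hfin.1 hfin.2, hfst.ncard_image,
    hsnd.ncard_image]
  exact ⟨_, rfl⟩

/-- Passing from `i` to a vertex `j > i`, the number of vertices weakly to the left grows by the
number of vertices strictly between `i` and `j`, plus one. -/
theorem ncard_vertices_le {V : Set ℤ} (hV : V.Finite) {i j : ℤ} (hij : i < j) (hj : j ∈ V) :
    (V ∩ Set.Iic j).ncard = (V ∩ Set.Iic i).ncard + (V ∩ Set.Ioo i j).ncard + 1 := by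
  have hsplit : V ∩ Set.Iic j = insert j ((V ∩ Set.Iic i) ∪ (V ∩ Set.Ioo i j)) := by
    rw [← Set.inter_union_distrib_left, Set.Iic_union_Ioo_eq_Iio hij, ← Set.Iio_insert,
      Set.inter_insert_of_mem hj]
  have hdisj : Disjoint (V ∩ Set.Iic i) (V ∩ Set.Ioo i j) :=
    Set.disjoint_left.2 fun _ hx hy => (not_lt.2 hx.2) hy.2.1
  rw [hsplit, Set.ncard_insert_of_notMem (by simp [hij])
    ((hV.inter_of_left _).union (hV.inter_of_left _)),
    Set.ncard_union_eq hdisj (hV.inter_of_left _) (hV.inter_of_left _)]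

theorem Weight.vertices_finite (l : Weight) : l.vertices.Finite :=
  l.finite.subset fun i hi => by
    rcases hi with h | h <;> simp [h]

theorem posn_eq (l : Weight) (i : ℤ) :
    posn l i = (l.vertices ∩ Set.Iic i).ncard + 2 * {j | j ≤ i ∧ l.lab j = Symb.times}.ncard := by
  rw [Set.inter_comm]
  rfl

/-- The distance `d_Λ(γ)` of any cup `γ = {i, j}` of a cup diagram compatible with a
block `Λ` is odd; in particular the saddle width `s_Λ(γ) = (d_Λ(γ) + 1)/2` is a
positive integer. -/
theorem cup_distance_odd (l : Weight) (c : CupDiagram)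
    (hc : c.IsCompatible l.vertices) (p : ℤ × ℤ) (hp : p ∈ c.cups) :
    Odd (arcDist l p.1 p.2) ∧ ∃ s : ℕ, 0 < s ∧ 2 * s = arcDist l p.1 p.2 + 1 := by
  have hodd : Odd (arcDist l p.1 p.2) := by
    obtain ⟨m, hm⟩ := even_ncard_vertices_below_cup hc hp
    have hstep := ncard_vertices_le l.vertices_finite (hc.1 p hp) (hc.2.1 p hp).2
    rw [arcDist, posn_eq, posn_eq, Int.natAbs_odd, Int.odd_iff]
    omega
  obtain ⟨k, hk⟩ := hodd
  exact ⟨⟨k, hk⟩, k + 1, k.succ_pos, by omega⟩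

end BK
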